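/- arXiv:0904.4081 — 2 statements merged into one kernel-verified Lean document; each statement's English description precedes it below -/
import Mathlib

section
/- Let λ ∈ ℂ with λ ≠ 0 and g(w) = λ·sin w. For every measurable function h : ℂ → [0, ∞], one has the change-of-variables identity ∫_ℂ ( ∑_{w ∈ g⁻¹(z)} h(w)/|g'(w)|² ) dz = ∫_ℂ h(w) dw, where for every z outside the Lebesgue-null set {λ, −λ} each point w in the fiber g⁻¹(z) satisfies g'(w) ≠ 0. -/
open MeasureTheory Complex

/-- The real Jacobian determinant of complex multiplication by `a` is `‖a‖ ^ 2`. -/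
lemma ofReal_abs_det_restrictScalars_toSpanSingleton (a : ℂ) :
    ENNReal.ofReal |((ContinuousLinearMap.toSpanSingleton ℂ a).restrictScalars ℝ).det|
      = (‖a‖₊ : ENNReal) ^ 2 := by
  have hdet : ((ContinuousLinearMap.toSpanSingleton ℂ a).restrictScalars ℝ).det = ‖a‖ ^ 2 := by
    simp [ContinuousLinearMap.det, LinearMap.det_restrictScalars, Algebra.norm_complex_apply,
      Complex.normSq_eq_norm_sq]
  rw [hdet, abs_of_nonneg (by positivity), ENNReal.ofReal_pow (norm_nonneg a),
    ofReal_norm, enorm_eq_nnnorm]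

/-- The regular points of an entire function are covered by countably many disjoint measurable
sets on which the function is injective. -/
lemma exists_disjoint_measurable_cover_injOn {f : ℂ → ℂ} (hf : Differentiable ℂ f) :
    ∃ A : ℕ → Set ℂ, (∀ n, MeasurableSet (A n)) ∧ Pairwise (Function.onFun Disjoint A) ∧
      (∀ n, Set.InjOn f (A n)) ∧ ⋃ n, A n = {w | deriv f w ≠ 0} := by
  have hU (x : ℂ) : ∃ U : Set ℂ, IsOpen U ∧ Set.InjOn f U ∧ (deriv f x ≠ 0 → x ∈ U) := by
    by_cases hx : deriv f x = 0
    · exact ⟨∅, isOpen_empty, by simp, fun h => absurd hx h⟩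
    · have hs : HasStrictDerivAt f (deriv f x) x := (hf.analyticAt x).hasStrictDerivAt
      let e := (hs.hasStrictFDerivAt_equiv hx).toOpenPartialHomeomorph f
      exact ⟨e.source, e.open_source, e.injOn,
        fun _ => (hs.hasStrictFDerivAt_equiv hx).mem_toOpenPartialHomeomorph_source⟩
  choose U hUo hUi hUm using hU
  obtain ⟨t, -, htc, hcover⟩ := TopologicalSpace.countable_cover_nhdsWithin
    (s := {w | deriv f w ≠ 0}) (f := U)
    fun x hx => mem_nhdsWithin_of_mem_nhds ((hUo x).mem_nhds (hUm x hx))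
  obtain ⟨u, hu⟩ := (htc.insert 0).exists_eq_range (Set.insert_nonempty 0 t)
  have hS : MeasurableSet {w | deriv f w ≠ 0} :=
    (measurable_deriv f (measurableSet_singleton 0)).compl
  refine ⟨fun n => disjointed (fun k => U (u k)) n ∩ {w | deriv f w ≠ 0},
    fun n => (MeasurableSet.disjointed (fun k => (hUo (u k)).measurableSet) n).inter hS,
    fun i j hij => (disjoint_disjointed _ hij).mono Set.inter_subset_left Set.inter_subset_left,
    fun n => (hUi (u n)).mono (Set.inter_subset_left.trans (disjointed_subset _ n)), ?_⟩
  rw [← Set.iUnion_inter, iUnion_disjointed, Set.inter_eq_right]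
  intro x hx
  obtain ⟨y, hy, hxy⟩ := Set.mem_iUnion₂.1 (hcover hx)
  obtain ⟨n, rfl⟩ : y ∈ Set.range u := hu ▸ Set.mem_insert_of_mem 0 hy
  exact Set.mem_iUnion.2 ⟨n, hxy⟩

/-- The critical values of an entire function form a null set. -/
lemma volume_image_deriv_eq_zero {f : ℂ → ℂ} (hf : Differentiable ℂ f) :
    volume (f '' {w | deriv f w = 0}) = 0 := by
  refine addHaar_image_eq_zero_of_det_fderivWithin_eq_zero volume
    (f' := fun w => (ContinuousLinearMap.toSpanSingleton ℂ (deriv f w)).restrictScalars ℝ)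
    (fun w _ => ((hf w).hasDerivAt.hasFDerivAt.restrictScalars ℝ).hasFDerivWithinAt) ?_
  intro w hw
  have hw0 : deriv f w = 0 := hw
  have h := ofReal_abs_det_restrictScalars_toSpanSingleton (deriv f w)
  rw [hw0] at h ⊢
  simpa using h

lemma tsum_fiber_indicator_eq_extend {α β : Type*} {f : α → β} {A : Set α} (hA : Set.InjOn f A)
    (φ : α → ENNReal) (z : β) :
    ∑' w : f ⁻¹' {z}, A.indicator φ w
      = Function.extend (A.domRestrict f) (fun w : A => φ w) 0 z := by
  by_cases hz : ∃ a : A, A.domRestrict f a = z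
  · obtain ⟨⟨a, ha⟩, rfl⟩ := hz
    rw [(Set.injOn_iff_injective.1 hA).extend_apply, tsum_eq_single ⟨a, rfl⟩]
    · exact Set.indicator_of_mem ha φ
    · rintro ⟨b, hb⟩ hne
      refine Set.indicator_of_notMem (fun hbA => hne ?_) φ
      exact Subtype.ext (hA hbA ha hb)
  · rw [Function.extend_apply' _ _ _ hz, Pi.zero_apply, ENNReal.tsum_eq_zero]
    rintro ⟨b, hb⟩
    exact Set.indicator_of_notMem (fun hbA => hz ⟨⟨b, hbA⟩, hb⟩) φ

/-- The area formula for entire functions. -/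
theorem lintegral_tsum_fiber_div_deriv {f : ℂ → ℂ} (hf : Differentiable ℂ f) {h : ℂ → ENNReal}
    (hh : Measurable h) :
    ∫⁻ z : ℂ, (∑' w : (f ⁻¹' {z}), h ↑w / (‖deriv f ↑w‖₊ : ENNReal) ^ 2)
      = ∫⁻ w in {w | deriv f w ≠ 0}, h w := by
  obtain ⟨A, hAm, hAd, hAi, hAu⟩ := exists_disjoint_measurable_cover_injOn hf
  let φ : ℂ → ENNReal := fun w => h w / (‖deriv f w‖₊ : ENNReal) ^ 2
  have hφ : Measurable φ :=
    hh.div ((measurable_deriv f).nnnorm.coe_nnreal_ennreal.pow_const 2)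
  have hderiv (n : ℕ) (w : ℂ) (_ : w ∈ A n) : HasFDerivWithinAt f
      ((ContinuousLinearMap.toSpanSingleton ℂ (deriv f w)).restrictScalars ℝ) (A n) w :=
    ((hf w).hasDerivAt.hasFDerivAt.restrictScalars ℝ).hasFDerivWithinAt
  have hsplit : ∀ᵐ z : ℂ, ∑' w : (f ⁻¹' {z}), φ w
      = ∑' n, ∑' w : (f ⁻¹' {z}), (A n).indicator φ w := by
    filter_upwards [measure_eq_zero_iff_ae_notMem.1 (volume_image_deriv_eq_zero hf)] with z hz
    rw [ENNReal.tsum_comm]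
    refine tsum_congr fun w => ?_
    have hw : (w : ℂ) ∈ ⋃ n, A n := by
      rw [hAu]
      exact fun h0 => hz ⟨w, h0, w.2⟩
    obtain ⟨n, hn⟩ := Set.mem_iUnion.1 hw
    rw [tsum_eq_single n, Set.indicator_of_mem hn]
    exact fun m hm => Set.indicator_of_notMem
      (fun hmw => Set.disjoint_left.1 (hAd hm) hmw hn) φ
  have hpiece (n : ℕ) : ∫⁻ z, ∑' w : (f ⁻¹' {z}), (A n).indicator φ w = ∫⁻ w in A n, h w := by
    have hsupp : (fun z => ∑' w : (f ⁻¹' {z}), (A n).indicator φ w)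
        = (f '' A n).indicator fun z => ∑' w : (f ⁻¹' {z}), (A n).indicator φ w := by
      refine (Set.indicator_eq_self.2 fun z hz => ?_).symm
      by_contra hzn
      refine hz (ENNReal.tsum_eq_zero.2 fun w => ?_)
      exact Set.indicator_of_notMem (fun hw => hzn ⟨w, hw, w.2⟩) φ
    rw [hsupp, lintegral_indicator (measurable_image_of_fderivWithin (hAm n) (hderiv n) (hAi n)),
      lintegral_image_eq_lintegral_abs_det_fderiv_mul volume (hAm n) (hderiv n) (hAi n)]
    refine setLIntegral_congr_fun (hAm n) fun w hw => ?_
    have hne : deriv f w ≠ 0 := by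
      have : w ∈ {w | deriv f w ≠ 0} := hAu ▸ Set.mem_iUnion_of_mem n hw
      exact this
    have hext : ∑' v : (f ⁻¹' {f w}), (A n).indicator φ v = φ w := by
      rw [tsum_fiber_indicator_eq_extend (hAi n)]
      exact (Set.injOn_iff_injective.1 (hAi n)).extend_apply _ _ (⟨w, hw⟩ : A n)
    rw [hext, ofReal_abs_det_restrictScalars_toSpanSingleton]
    exact ENNReal.mul_div_cancel (by simpa using hne) (by finiteness)
  calc ∫⁻ z : ℂ, ∑' w : (f ⁻¹' {z}), φ w
      = ∫⁻ z : ℂ, ∑' n, ∑' w : (f ⁻¹' {z}), (A n).indicator φ w := lintegral_congr_ae hsplit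
    _ = ∑' n, ∫⁻ z : ℂ, ∑' w : (f ⁻¹' {z}), (A n).indicator φ w := by
        refine lintegral_tsum fun n => Measurable.aemeasurable ?_
        simp_rw [tsum_fiber_indicator_eq_extend (hAi n)]
        exact (measurableEmbedding_of_fderivWithin (hAm n) (hderiv n) (hAi n)).measurable_extend
          (hφ.comp measurable_subtype_coe) measurable_zero
    _ = ∑' n, ∫⁻ w in A n, h w := tsum_congr hpiece
    _ = ∫⁻ w in {w | deriv f w ≠ 0}, h w := by rw [← hAu, lintegral_iUnion hAm hAd]

lemma countable_setOf_cos_eq_zero : {w : ℂ | Complex.cos w = 0}.Countable := by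
  refine (Set.countable_range fun k : ℤ => (2 * k + 1) * (Real.pi : ℂ) / 2).mono fun w hw => ?_
  obtain ⟨k, hk⟩ := Complex.cos_eq_zero_iff.1 hw
  exact ⟨k, hk.symm⟩

/-- Change of variables for `g(w) = λ·sin w`: for every measurable `h : ℂ → [0,∞]`,
`∫ (∑_{w ∈ g⁻¹(z)} h(w)/|g'(w)|²) dz = ∫ h(w) dw`; moreover outside the null set
`{λ, −λ}` every point of the fiber is a regular point of `g`. -/
theorem sine_change_of_variables (lam : ℂ) (hlam : lam ≠ 0)
    (g : ℂ → ℂ) (hg : ∀ w : ℂ, g w = lam * Complex.sin w) :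
    (∀ z : ℂ, z ∉ ({lam, -lam} : Set ℂ) →
      ∀ w ∈ g ⁻¹' {z}, lam * Complex.cos w ≠ 0) ∧
    ∀ h : ℂ → ENNReal, Measurable h →
      ∫⁻ z : ℂ, (∑' w : (g ⁻¹' {z}), h ↑w / (‖lam * Complex.cos ↑w‖₊ : ENNReal) ^ 2)
        = ∫⁻ w : ℂ, h w := by
  constructor
  · rintro z hz w rfl hw
    have hcos : Complex.cos w = 0 := (mul_eq_zero.1 hw).resolve_left hlam
    have hsin : Complex.sin w ^ 2 = 1 := by
      simpa [hcos] using Complex.sin_sq_add_cos_sq w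
    rcases sq_eq_one_iff.1 hsin with h1 | h1 <;> simp [hg, h1] at hz
  · intro h hh
    have hderiv (w : ℂ) : HasDerivAt g (lam * Complex.cos w) w := by
      rw [funext hg]
      exact (Complex.hasDerivAt_sin w).const_mul lam
    have key := lintegral_tsum_fiber_div_deriv (fun w => (hderiv w).differentiableAt) hh
    simp_rw [(hderiv _).deriv] at key
    rw [key, Measure.restrict_eq_self_of_ae_mem]
    filter_upwards [countable_setOf_cos_eq_zero.ae_notMem volume] with w hw
    exact mul_ne_zero hlam hw
end

section
/- Let λ ∈ ℂ with λ ≠ 0 and g(w) = λ·sin w. Let S ⊂ ℂ be a finite set, let q̃ : ℂ → ℂ be holomorphic on ℂ \ S and integrable on ℂ, and assume that for every z ∈ ℂ the family (q̃(w)/(g'(w))²) over w ∈ g⁻¹(z) is absolutely summable; let q(z) = ∑_{w ∈ g⁻¹(z)} q̃(w)/(g'(w))² and assume q is integrable on ℂ. Let ξ : ℂ → ℂ be a bounded measurable function and define ξ̃(w) = ξ(g(w))·conj(g'(w))/g'(w) when g'(w) ≠ 0 and ξ̃(w) = 0 when g'(w) = 0. Then ∫_ℂ ξ̃(w)·q̃(w)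 dw = ∫_ℂ ξ(z)·q(z) dz. -/
open MeasureTheory Complex

/-- The real Jacobian determinant of multiplication by a complex number `a` is `|a|²`. -/
theorem det_restrictScalars_toSpanSingleton (a : ℂ) :
    ((ContinuousLinearMap.toSpanSingleton ℂ a).restrictScalars ℝ).det = normSq a := by
  simp [ContinuousLinearMap.det, LinearMap.det_restrictScalars, Algebra.norm_complex_apply]

theorem volume_re_eq (c : ℝ) : volume {w : ℂ | w.re = c} = 0 := by
  have h : {w : ℂ | w.re = c} = Complex.measurableEquivRealProd ⁻¹' ({c} ×ˢ Set.univ) := by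
    ext w
    simp [Complex.measurableEquivRealProd_apply]
  rw [h, Complex.volume_preserving_equiv_real_prod.measure_preimage_equiv,
    Measure.volume_eq_prod, Measure.prod_prod]
  simp

/-- The open vertical strip of width `π` centred at `n * π`. -/
def verticalStrip (n : ℤ) : Set ℂ :=
  {w | (n - 1 / 2) * Real.pi < w.re ∧ w.re < (n + 1 / 2) * Real.pi}

theorem measurableSet_verticalStrip (n : ℤ) : MeasurableSet (verticalStrip n) :=
  (measurableSet_lt measurable_const Complex.measurable_re).inter
    (measurableSet_lt Complex.measurable_re measurable_const)

theorem pairwise_disjoint_verticalStrip :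
    Pairwise (Function.onFun Disjoint verticalStrip) := by
  intro m n hmn
  refine Set.disjoint_left.2 fun w hm hn => hmn ?_
  have h₁ : ((m : ℝ) - 1 / 2) < n + 1 / 2 :=
    lt_of_mul_lt_mul_right (hm.1.trans hn.2) Real.pi_pos.le
  have h₂ : ((n : ℝ) - 1 / 2) < m + 1 / 2 :=
    lt_of_mul_lt_mul_right (hn.1.trans hm.2) Real.pi_pos.le
  have h₃ : m < n + 1 := by exact_mod_cast (by linarith : (m : ℝ) < n + 1)
  have h₄ : n < m + 1 := by exact_mod_cast (by linarith : (n : ℝ) < m + 1)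
  omega

theorem volume_compl_iUnion_verticalStrip : volume (⋃ n, verticalStrip n)ᶜ = 0 := by
  refine measure_mono_null (t := ⋃ n : ℤ, {w : ℂ | w.re = (n - 1 / 2) * Real.pi}) ?_
    (measure_iUnion_null fun n => volume_re_eq _)
  intro w hw
  have hpi := Real.pi_pos
  have h₁ : (⌊w.re / Real.pi + 1 / 2⌋ - 1 / 2) * Real.pi ≤ w.re := by
    rw [← le_div_iff₀ hpi]
    linarith [Int.floor_le (w.re / Real.pi + 1 / 2)]
  have h₂ : w.re < (⌊w.re / Real.pi + 1 / 2⌋ + 1 / 2) * Real.pi := by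
    rw [← div_lt_iff₀ hpi]
    linarith [Int.lt_floor_add_one (w.re / Real.pi + 1 / 2)]
  refine Set.mem_iUnion.2 ⟨⌊w.re / Real.pi + 1 / 2⌋, ?_⟩
  by_contra hne
  exact hw (Set.mem_iUnion.2 ⟨_, lt_of_le_of_ne h₁ (Ne.symm hne), h₂⟩)

theorem injOn_sin_verticalStrip (n : ℤ) : Set.InjOn Complex.sin (verticalStrip n) := by
  intro x hx y hy hxy
  have hpi := Real.pi_pos
  obtain ⟨hx₁, hx₂⟩ := hx
  obtain ⟨hy₁, hy₂⟩ := hy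
  obtain ⟨k, hk | hk⟩ := Complex.sin_eq_sin_iff.1 hxy
  · have hre : y.re = 2 * k * Real.pi + x.re := by simpa using congrArg Complex.re hk
    have h₁ : (2 * k : ℝ) < 1 := lt_of_mul_lt_mul_right (by linarith) hpi.le
    have h₂ : (-1 : ℝ) < 2 * k := lt_of_mul_lt_mul_right (by linarith) hpi.le
    have h₃ : 2 * k < 1 := by exact_mod_cast h₁
    have h₄ : -1 < 2 * k := by exact_mod_cast h₂
    obtain rfl : k = 0 := by omega
    simpa using hk.symm
  · have hre : y.re = (2 * k + 1) * Real.pi - x.re := by simpa using congrArg Complex.re hk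
    have h₁ : (2 * k + 1 : ℝ) < 2 * n + 1 := lt_of_mul_lt_mul_right (by linarith) hpi.le
    have h₂ : (2 * n - 1 : ℝ) < 2 * k + 1 := lt_of_mul_lt_mul_right (by linarith) hpi.le
    have h₃ : 2 * k + 1 < 2 * n + 1 := by exact_mod_cast h₁
    have h₄ : 2 * n - 1 < 2 * k + 1 := by exact_mod_cast h₂
    omega

/-- If the sets `A i` are pairwise disjoint, `g` is injective on each of them and they cover the
fiber of `g` over `z`, then a sum over that fiber is the sum over `i` of the contributions of the
branches `(g|A i)⁻¹`. -/
theorem tsum_fiber_eq_tsum_indicator {ι α β M : Type*} [Nonempty α] [AddCommMonoid M]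
    [TopologicalSpace M] {A : ι → Set α} {g : α → β} (hdisj : Pairwise (Function.onFun Disjoint A))
    (hinj : ∀ i, Set.InjOn g (A i)) (h : α → M) {z : β} (hz : g ⁻¹' {z} ⊆ ⋃ i, A i) :
    ∑' w : (g ⁻¹' {z}), h w =
      ∑' i, (g '' A i).indicator (fun z => h (Function.invFunOn g (A i) z)) z := by
  have hmem : ∀ i : {i | z ∈ g '' A i}, Function.invFunOn g (A i) z ∈ A i :=
    fun i => Function.invFunOn_mem i.2
  have heq : ∀ i : {i | z ∈ g '' A i}, g (Function.invFunOn g (A i) z) = z :=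
    fun i => Function.invFunOn_eq i.2
  let e : {i | z ∈ g '' A i} → (g ⁻¹' {z}) := fun i => ⟨Function.invFunOn g (A i) z, heq i⟩
  have he : Function.Bijective e := by
    constructor
    · intro i j hij
      by_contra hne
      have hij' : Function.invFunOn g (A i) z = Function.invFunOn g (A j) z :=
        congrArg Subtype.val hij
      exact Set.disjoint_left.1 (hdisj fun hc => hne (Subtype.ext hc)) (hmem i)
        (hij' ▸ hmem j)
    · rintro ⟨w, hw⟩
      obtain ⟨i, hi⟩ := Set.mem_iUnion.1 (hz hw)
      have hi' : z ∈ g '' A i := ⟨w, hi, hw⟩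
      exact ⟨⟨i, hi'⟩, Subtype.ext (hinj i (hmem ⟨i, hi'⟩) hi ((heq ⟨i, hi'⟩).trans hw.symm))⟩
  rw [← (Equiv.ofBijective e he).tsum_eq fun w => h w]
  refine (tsum_subtype {i | z ∈ g '' A i} fun i => h (Function.invFunOn g (A i) z)).trans ?_
  rfl

/-- Change of variables for a holomorphic map which is injective on each piece of a countable
measurable partition (up to a null set) of the plane. -/
theorem integral_normSq_mul_eq_integral_tsum_fiber {ι : Type*} [Countable ι] {A : ι → Set ℂ}
    {g g' : ℂ → ℂ} (hg : ∀ w, HasDerivAt g (g' w) w) (hA : ∀ i, MeasurableSet (A i))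
    (hdisj : Pairwise (Function.onFun Disjoint A)) (hnull : volume (⋃ i, A i)ᶜ = 0)
    (hinj : ∀ i, Set.InjOn g (A i)) {h : ℂ → ℂ}
    (hint : Integrable fun w => (normSq (g' w) : ℂ) * h w) :
    ∫ w, (normSq (g' w) : ℂ) * h w = ∫ z, ∑' w : (g ⁻¹' {z}), h w := by
  let F : ι → ℂ → ℂ := fun i =>
    (g '' A i).indicator fun z => h (Function.invFunOn g (A i) z)
  have hderiv : ∀ i, ∀ w ∈ A i, HasFDerivWithinAt g
      ((ContinuousLinearMap.toSpanSingleton ℂ (g' w)).restrictScalars ℝ) (A i) w :=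
    fun i w _ => ((hg w).hasFDerivAt.restrictScalars ℝ).hasFDerivWithinAt
  have hcont : Continuous g := continuous_iff_continuousAt.2 fun w => (hg w).continuousAt
  have himg : ∀ i, MeasurableSet (g '' A i) := fun i =>
    (hA i).image_of_continuousOn_injOn hcont.continuousOn (hinj i)
  have hinv : ∀ i, ∀ w ∈ A i, Function.invFunOn g (A i) (g w) = w :=
    fun i => (hinj i).leftInvOn_invFunOn
  have hpull : ∀ i, Set.EqOn (fun w =>
      |((ContinuousLinearMap.toSpanSingleton ℂ (g' w)).restrictScalars ℝ).det| •
        h (Function.invFunOn g (A i) (g w))) (fun w => (normSq (g' w) : ℂ) * h w) (A i) := by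
    intro i w hw
    simp only [det_restrictScalars_toSpanSingleton, abs_of_nonneg (normSq_nonneg _), hinv i w hw,
      real_smul]
  have hF : ∀ i, Integrable (F i) := by
    intro i
    rw [integrable_indicator_iff (himg i),
      integrableOn_image_iff_integrableOn_abs_det_fderiv_smul volume (hA i) (hderiv i) (hinj i),
      integrableOn_congr_fun (hpull i) (hA i)]
    exact hint.integrableOn
  have hFint : ∀ i, ∫ z, F i z = ∫ w in A i, (normSq (g' w) : ℂ) * h w := by
    intro i
    rw [integral_indicator (himg i),
      integral_image_eq_integral_abs_det_fderiv_smul volume (hA i) (hderiv i) (hinj i),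
      setIntegral_congr_fun (hA i) (hpull i)]
  have hFnorm : ∀ i, ∫ z, ‖F i z‖ = ∫ w in A i, ‖(normSq (g' w) : ℂ) * h w‖ := by
    intro i
    simp only [F, norm_indicator_eq_indicator_norm]
    rw [integral_indicator (himg i),
      integral_image_eq_integral_abs_det_fderiv_smul volume (hA i) (hderiv i) (hinj i)]
    refine setIntegral_congr_fun (hA i) fun w hw => ?_
    simp only [← hpull i hw, norm_smul, Real.norm_eq_abs, abs_abs, smul_eq_mul]
  have hsum : Summable fun i => ∫ z, ‖F i z‖ := by
    simp only [hFnorm]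
    exact (hasSum_integral_iUnion hA hdisj hint.norm.integrableOn).summable
  have hcover : (⋃ i, A i) =ᵐ[volume] Set.univ := by
    rwa [ae_eq_univ]
  have himg_null : volume (g '' (⋃ i, A i)ᶜ) = 0 :=
    addHaar_image_eq_zero_of_differentiableOn_of_addHaar_eq_zero volume
      (fun w _ => ((hg w).hasFDerivAt.restrictScalars ℝ).differentiableAt.differentiableWithinAt)
      hnull
  calc ∫ w, (normSq (g' w) : ℂ) * h w
      = ∫ w in ⋃ i, A i, (normSq (g' w) : ℂ) * h w := by
        rw [setIntegral_congr_set hcover, setIntegral_univ]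
    _ = ∑' i, ∫ w in A i, (normSq (g' w) : ℂ) * h w :=
        integral_iUnion hA hdisj hint.integrableOn
    _ = ∑' i, ∫ z, F i z := by simp only [hFint]
    _ = ∫ z, ∑' i, F i z := integral_tsum_of_summable_integral_norm hF hsum
    _ = ∫ z, ∑' w : (g ⁻¹' {z}), h w := by
        refine integral_congr_ae ?_
        filter_upwards [measure_eq_zero_iff_ae_notMem.1 himg_null] with z hz
        refine (tsum_fiber_eq_tsum_indicator hdisj hinj h fun w hw => ?_).symm
        by_contra hc
        exact hz ⟨w, hc, hw⟩

/-- Duality of the pairing between the pull-back of a Beltrami differential `ξ` and the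
push-forward of a quadratic differential `q̃` through `g(w) = λ·sin w`:
`∫ ξ̃·q̃ = ∫ ξ·q`. -/
theorem pairing_duality (lam : ℂ) (hlam : lam ≠ 0)
    (g : ℂ → ℂ) (hg : ∀ w : ℂ, g w = lam * Complex.sin w)
    (S : Set ℂ) (hS : S.Finite)
    (qt : ℂ → ℂ) (hqt : ∀ w : ℂ, w ∉ S → DifferentiableAt ℂ qt w)
    (hqtint : Integrable qt)
    (hsum : ∀ z : ℂ, Summable fun w : (g ⁻¹' {z}) =>
      ‖qt ↑w / (lam * Complex.cos ↑w) ^ 2‖)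
    (q : ℂ → ℂ)
    (hq : ∀ z : ℂ, q z = ∑' w : (g ⁻¹' {z}), qt ↑w / (lam * Complex.cos ↑w) ^ 2)
    (hqint : Integrable q)
    (xi : ℂ → ℂ) (hxi_meas : Measurable xi) (C : ℝ) (hxi_bdd : ∀ z : ℂ, ‖xi z‖ ≤ C)
    (xit : ℂ → ℂ)
    (hxit : ∀ w : ℂ, xit w =
      if lam * Complex.cos w = 0 then 0
      else xi (g w) * (starRingEnd ℂ) (lam * Complex.cos w) / (lam * Complex.cos w)) :
    ∫ w : ℂ, xit w * qt w = ∫ z : ℂ, xi z * q z := by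
  obtain rfl : g = fun w => lam * Complex.sin w := funext hg
  let h : ℂ → ℂ := fun w =>
    xi (lam * Complex.sin w) * (qt w / (lam * Complex.cos w) ^ 2)
  have hpull : ∀ w, xit w * qt w = (normSq (lam * Complex.cos w) : ℂ) * h w := by
    intro w
    rw [hxit]
    split_ifs with h0
    · simp [h0]
    · simp only [h, ← mul_conj]
      field_simp
  have hpush : ∀ z, xi z * q z = ∑' w : ((fun w => lam * Complex.sin w) ⁻¹' {z}), h w := by
    intro z
    rw [hq, ← tsum_mul_left]
    refine tsum_congr fun w => ?_
    have hw : lam * Complex.sin w = z := w.2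
    simp only [h, hw]
  have hxit_meas : Measurable xit := by
    rw [funext hxit]
    have hcos : Measurable fun w => lam * Complex.cos w :=
      Complex.measurable_cos.const_mul lam
    refine Measurable.ite (hcos (measurableSet_singleton 0)) measurable_const ?_
    exact ((hxi_meas.comp (Complex.measurable_sin.const_mul lam)).mul
      (Complex.continuous_conj.measurable.comp hcos)).div hcos
  have hxit_bdd : ∀ w, ‖xit w‖ ≤ C := by
    intro w
    rw [hxit]
    split_ifs with h0
    · simpa using (norm_nonneg _).trans (hxi_bdd 0)
    · rw [norm_div, norm_mul, RCLike.norm_conj, mul_div_cancel_right₀ _ (norm_ne_zero_iff.2 h0)]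
      exact hxi_bdd _
  have hint : Integrable fun w => (normSq (lam * Complex.cos w) : ℂ) * h w := by
    simp only [← hpull]
    exact hqtint.bdd_mul hxit_meas.aestronglyMeasurable (Filter.Eventually.of_forall hxit_bdd)
  simp only [hpull, hpush]
  exact integral_normSq_mul_eq_integral_tsum_fiber
    (fun w => (Complex.hasDerivAt_sin w).const_mul lam) measurableSet_verticalStrip
    pairwise_disjoint_verticalStrip volume_compl_iUnion_verticalStrip
    (fun n x hx y hy hxy => injOn_sin_verticalStrip n hx hy (mul_left_cancel₀ hlam hxy)) hint
end
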